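/- arXiv:1510.03394 — 2 statements merged into one kernel-verified Lean document; each statement's English description precedes it below -/
import Mathlib

section
/- Let α ≥ 1 and β ≥ 0 be real numbers. For every unit vector ψ ∈ ℂ^(Fin 2 × Fin 2) and all 2×2 complex Hermitian matrices A₀, A₁, B₀, B₁ satisfying A₀² = A₁² = B₀² = B₁² = 1 (i.e. ±1-valued qubit observables), the Bell expression satisfies I_{α,β} ≤ √((1+α²)(4+β²)). -/
noncomputable section

open Matrix Kronecker

/-- Two-qubit expectation value ⟨A ⊗ B⟩ in state ψ. -/
def expVal (A B : Matrix (Fin 2) (Fin 2) ℂ) (ψ : Fin 2 × Fin 2 → ℂ) : ℂ :=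
  star ψ ⬝ᵥ ((A ⊗ₖ B).mulVec ψ)

/-- Sum-of-squares decomposition of `(1 + α²)(4 + β²) - I²` for the tilted CHSH operator `I`. -/
lemma tilted_chsh_sum_of_squares {R : Type*} [Ring R] [Algebra ℝ R] (α β γ : ℝ) (hγ : α * γ = 1)
    (a0 a1 b0 b1 : R) (ha0 : a0 * a0 = 1) (ha1 : a1 * a1 = 1) (hb0 : b0 * b0 = 1)
    (hb1 : b1 * b1 = 1) (h00 : b0 * a0 = a0 * b0) (h01 : b0 * a1 = a1 * b0)
    (h10 : b1 * a0 = a0 * b1) (h11 : b1 * a1 = a1 * b1) (I P Q : R)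
    (hI : I = β • b0 + α • (a0 * b0 + a1 * b0) + a0 * b1 - a1 * b1)
    (hP : P = (a0 - a1) * (b0 * b1 + b1 * b0))
    (hQ : Q = (a0 - a1) * (b0 * b1 - b1 * b0)) :
    ((1 + α ^ 2) * (4 + β ^ 2)) • (1 : R) = I * I +
      ((α * β) • (1 : R) - (a0 + a1) - (γ / 2) • P - (α / 2) • Q) *
      ((α * β) • (1 : R) - (a0 + a1) - (γ / 2) • P + (α / 2) • Q) +
      ((α ^ 2 - γ ^ 2) / 4) • (P * P) := by
  have ca0 (x : R) : a0 * (a0 * x) = x := by rw [← mul_assoc, ha0, one_mul]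
  have ca1 (x : R) : a1 * (a1 * x) = x := by rw [← mul_assoc, ha1, one_mul]
  have cb0 (x : R) : b0 * (b0 * x) = x := by rw [← mul_assoc, hb0, one_mul]
  have cb1 (x : R) : b1 * (b1 * x) = x := by rw [← mul_assoc, hb1, one_mul]
  have c00 (x : R) : b0 * (a0 * x) = a0 * (b0 * x) := by rw [← mul_assoc, h00, mul_assoc]
  have c01 (x : R) : b0 * (a1 * x) = a1 * (b0 * x) := by rw [← mul_assoc, h01, mul_assoc]
  have c10 (x : R) : b1 * (a0 * x) = a0 * (b1 * x) := by rw [← mul_assoc, h10, mul_assoc]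
  have c11 (x : R) : b1 * (a1 * x) = a1 * (b1 * x) := by rw [← mul_assoc, h11, mul_assoc]
  subst hI hP hQ
  simp only [mul_add, add_mul, mul_sub, sub_mul, smul_mul_assoc, mul_smul_comm, mul_assoc,
    smul_add, smul_sub, mul_one, one_mul, ha0, ha1, hb0, hb1, h00, h01, h10, h11,
    ca0, ca1, cb0, cb1, c00, c01, c10, c11]
  match_scalars <;> first | ring1 | linear_combination β * hγ | linear_combination -β * hγ

open scoped ComplexOrder in
lemma re_dotProduct_conjTranspose_mul_self_mulVec_nonneg {n : Type*} [Fintype n]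
    (N : Matrix n n ℂ) (ψ : n → ℂ) : 0 ≤ (star ψ ⬝ᵥ (Nᴴ * N) *ᵥ ψ).re :=
  (Complex.le_def.1 ((posSemidef_conjTranspose_mul_self N).dotProduct_mulVec_nonneg ψ)).1

/-- The square of the expectation of a Hermitian matrix is at most the expectation of its square. -/
lemma re_dotProduct_mulVec_sq_le {n : Type*} [Fintype n] [DecidableEq n] {M : Matrix n n ℂ}
    (hM : M.IsHermitian) {ψ : n → ℂ} (hψ : star ψ ⬝ᵥ ψ = 1) :
    (star ψ ⬝ᵥ M *ᵥ ψ).re ^ 2 ≤ (star ψ ⬝ᵥ (M * M) *ᵥ ψ).re := by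
  set t : ℝ := (star ψ ⬝ᵥ M *ᵥ ψ).re with ht
  have hN : (M - t • (1 : Matrix n n ℂ))ᴴ = M - t • (1 : Matrix n n ℂ) := by
    simp [conjTranspose_sub, conjTranspose_smul, hM.eq]
  have key := re_dotProduct_conjTranspose_mul_self_mulVec_nonneg (M - t • (1 : Matrix n n ℂ)) ψ
  rw [hN] at key
  have e : (M - t • (1 : Matrix n n ℂ)) * (M - t • (1 : Matrix n n ℂ))
      = M * M - (2 * t) • M + (t ^ 2) • (1 : Matrix n n ℂ) := by
    simp only [mul_sub, sub_mul, smul_mul_assoc, mul_smul_comm, mul_one, one_mul, smul_sub]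
    module
  rw [e] at key
  simp only [add_mulVec, sub_mulVec, smul_mulVec, one_mulVec, dotProduct_add, dotProduct_sub,
    dotProduct_smul, hψ, Complex.add_re, Complex.sub_re, Complex.smul_re, Complex.one_re,
    smul_eq_mul, ← ht] at key
  nlinarith

theorem quantum_bound_on_I_alpha_beta (α β : ℝ) (hα : 1 ≤ α) (hβ : 0 ≤ β)
    (ψ : Fin 2 × Fin 2 → ℂ) (hψ : star ψ ⬝ᵥ ψ = 1)
    (A0 A1 B0 B1 : Matrix (Fin 2) (Fin 2) ℂ)
    (hA0 : A0.IsHermitian) (hA1 : A1.IsHermitian)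
    (hB0 : B0.IsHermitian) (hB1 : B1.IsHermitian)
    (hA0sq : A0 * A0 = 1) (hA1sq : A1 * A1 = 1)
    (hB0sq : B0 * B0 = 1) (hB1sq : B1 * B1 = 1) :
    ((β : ℂ) * expVal 1 B0 ψ + (α : ℂ) * (expVal A0 B0 ψ + expVal A1 B0 ψ)
        + expVal A0 B1 ψ - expVal A1 B1 ψ).re
      ≤ Real.sqrt ((1 + α ^ 2) * (4 + β ^ 2)) := by
  have left_sq {A : Matrix (Fin 2) (Fin 2) ℂ} (h : A * A = 1) :
      (A ⊗ₖ (1 : Matrix (Fin 2) (Fin 2) ℂ)) * (A ⊗ₖ 1) = 1 := by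
    rw [← mul_kronecker_mul, h, mul_one, one_kronecker_one]
  have right_sq {B : Matrix (Fin 2) (Fin 2) ℂ} (h : B * B = 1) :
      ((1 : Matrix (Fin 2) (Fin 2) ℂ) ⊗ₖ B) * (1 ⊗ₖ B) = 1 := by
    rw [← mul_kronecker_mul, h, mul_one, one_kronecker_one]
  have split (A B : Matrix (Fin 2) (Fin 2) ℂ) : (A ⊗ₖ 1) * (1 ⊗ₖ B) = A ⊗ₖ B := by
    rw [← mul_kronecker_mul, mul_one, one_mul]
  have comm (A B : Matrix (Fin 2) (Fin 2) ℂ) :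
      (1 ⊗ₖ B) * (A ⊗ₖ 1) = (A ⊗ₖ 1) * (1 ⊗ₖ B) := by
    rw [split, ← mul_kronecker_mul, mul_one, one_mul]
  have sa0 : (A0 ⊗ₖ (1 : Matrix (Fin 2) (Fin 2) ℂ))ᴴ = A0 ⊗ₖ 1 := by
    rw [conjTranspose_kronecker, hA0.eq, conjTranspose_one]
  have sa1 : (A1 ⊗ₖ (1 : Matrix (Fin 2) (Fin 2) ℂ))ᴴ = A1 ⊗ₖ 1 := by
    rw [conjTranspose_kronecker, hA1.eq, conjTranspose_one]
  have sb0 : ((1 : Matrix (Fin 2) (Fin 2) ℂ) ⊗ₖ B0)ᴴ = 1 ⊗ₖ B0 := by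
    rw [conjTranspose_kronecker, hB0.eq, conjTranspose_one]
  have sb1 : ((1 : Matrix (Fin 2) (Fin 2) ℂ) ⊗ₖ B1)ᴴ = 1 ⊗ₖ B1 := by
    rw [conjTranspose_kronecker, hB1.eq, conjTranspose_one]
  have sos := tilted_chsh_sum_of_squares α β α⁻¹ (mul_inv_cancel₀ (by positivity))
    _ _ _ _ (left_sq hA0sq) (left_sq hA1sq) (right_sq hB0sq) (right_sq hB1sq)
    (comm A0 B0) (comm A1 B0) (comm A0 B1) (comm A1 B1) _ _ _ rfl rfl rfl
  have hval : (β : ℂ) * expVal 1 B0 ψ + (α : ℂ) * (expVal A0 B0 ψ + expVal A1 B0 ψ)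
        + expVal A0 B1 ψ - expVal A1 B1 ψ = star ψ ⬝ᵥ (β • (1 ⊗ₖ B0) +
        α • ((A0 ⊗ₖ 1) * (1 ⊗ₖ B0) + (A1 ⊗ₖ 1) * (1 ⊗ₖ B0)) +
        (A0 ⊗ₖ 1) * (1 ⊗ₖ B1) - (A1 ⊗ₖ 1) * (1 ⊗ₖ B1)) *ᵥ ψ := by
    simp only [split, expVal, add_mulVec, sub_mulVec, smul_mulVec, dotProduct_add,
      dotProduct_sub, dotProduct_smul, Complex.real_smul]
  rw [hval]
  have c00 := comm A0 B0
  have c01 := comm A1 B0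
  have c10 := comm A0 B1
  have c11 := comm A1 B1
  generalize A0 ⊗ₖ (1 : Matrix (Fin 2) (Fin 2) ℂ) = a0 at *
  generalize A1 ⊗ₖ (1 : Matrix (Fin 2) (Fin 2) ℂ) = a1 at *
  generalize (1 : Matrix (Fin 2) (Fin 2) ℂ) ⊗ₖ B0 = b0 at *
  generalize (1 : Matrix (Fin 2) (Fin 2) ℂ) ⊗ₖ B1 = b1 at *
  have hI : (β • b0 + α • (a0 * b0 + a1 * b0) + a0 * b1 - a1 * b1).IsHermitian := by
    simp only [IsHermitian, conjTranspose_add, conjTranspose_sub, conjTranspose_smul,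
      conjTranspose_mul, sa0, sa1, sb0, sb1, c00, c01, c10, c11, star_trivial]
  have k0 : (b0 * b1 + b1 * b0) * a0 = a0 * (b0 * b1 + b1 * b0) := by
    simp only [add_mul, mul_add, mul_assoc, c00, c10]
    simp only [← mul_assoc, c00, c10]
  have k1 : (b0 * b1 + b1 * b0) * a1 = a1 * (b0 * b1 + b1 * b0) := by
    simp only [add_mul, mul_add, mul_assoc, c01, c11]
    simp only [← mul_assoc, c01, c11]
  have l0 : (b1 * b0 - b0 * b1) * a0 = a0 * (b1 * b0 - b0 * b1) := by
    simp only [sub_mul, mul_sub, mul_assoc, c00, c10]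
    simp only [← mul_assoc, c00, c10]
  have l1 : (b1 * b0 - b0 * b1) * a1 = a1 * (b1 * b0 - b0 * b1) := by
    simp only [sub_mul, mul_sub, mul_assoc, c01, c11]
    simp only [← mul_assoc, c01, c11]
  have hP : ((a0 - a1) * (b0 * b1 + b1 * b0))ᴴ = (a0 - a1) * (b0 * b1 + b1 * b0) := by
    simp only [conjTranspose_mul, conjTranspose_add, conjTranspose_sub, sa0, sa1, sb0, sb1]
    rw [add_comm (b1 * b0), mul_sub, sub_mul, k0, k1]
  have hQ : ((a0 - a1) * (b0 * b1 - b1 * b0))ᴴ = -((a0 - a1) * (b0 * b1 - b1 * b0)) := by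
    simp only [conjTranspose_mul, conjTranspose_sub, sa0, sa1, sb0, sb1]
    rw [mul_sub, l0, l1, ← sub_mul, ← mul_neg, neg_sub]
  have hsq := re_dotProduct_mulVec_sq_le hI hψ
  generalize β • b0 + α • (a0 * b0 + a1 * b0) + a0 * b1 - a1 * b1 = I at *
  generalize (a0 - a1) * (b0 * b1 + b1 * b0) = P at *
  generalize (a0 - a1) * (b0 * b1 - b1 * b0) = Q at *
  have hX : ((α * β) • (1 : Matrix (Fin 2 × Fin 2) (Fin 2 × Fin 2) ℂ) - (a0 + a1)
      - (α⁻¹ / 2) • P + (α / 2) • Q)ᴴ = (α * β) • 1 - (a0 + a1) - (α⁻¹ / 2) • P - (α / 2) • Q := by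
    simp only [conjTranspose_add, conjTranspose_sub, conjTranspose_smul, conjTranspose_one,
      sa0, sa1, hP, hQ, star_trivial, smul_neg, ← sub_eq_add_neg]
  have posX := re_dotProduct_conjTranspose_mul_self_mulVec_nonneg
    ((α * β) • (1 : Matrix (Fin 2 × Fin 2) (Fin 2 × Fin 2) ℂ) - (a0 + a1)
      - (α⁻¹ / 2) • P + (α / 2) • Q) ψ
  have posP := re_dotProduct_conjTranspose_mul_self_mulVec_nonneg P ψ
  rw [hX] at posX
  rw [hP] at posP
  have hcoef : 0 ≤ (α ^ 2 - α⁻¹ ^ 2) / 4 := by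
    have h1 : α⁻¹ ≤ 1 := inv_le_one_of_one_le₀ hα
    have h2 : 0 ≤ α⁻¹ := by positivity
    nlinarith
  have hexp := congrArg (fun M => (star ψ ⬝ᵥ M *ᵥ ψ).re) sos
  simp only [add_mulVec _ _ ψ, smul_mulVec _ _ ψ, one_mulVec, dotProduct_add, dotProduct_smul,
    hψ, Complex.add_re, Complex.smul_re, Complex.one_re, smul_eq_mul, mul_one] at hexp
  apply Real.le_sqrt_of_sq_le
  have := mul_nonneg hcoef posP
  linarith
end
end

section
/- Let β ∈ [0, 2). For every unit vector ψ ∈ ℂ^(Fin 2 × Fin 2) and all 2×2 complex Hermitian matrices A₀, A₁, B₀, B₁ with A₀² = A₁² = B₀² = B₁² = 1, if the Bell expression attains its maximal quantum value, I_{1,β} = √(2(4+β²)), then ⟨ψ, (1 ⊗ₖ B₁).mulVec ψ⟩ = 0; that is, at maximal violation the two outcomes of the measurement B₁ each occur with probability 1/2, certifying one perfect random bit. -/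
noncomputable section

open Matrix Kronecker

/-- The tilted Bell operator and its companion have squares summing to a scalar. -/
theorem tiltedBell_sq_add_sq {R : Type*} [Ring R] [Algebra ℝ R] {a₀ a₁ b₀ b₁ : R} {β : ℝ}
    (ha₀ : a₀ * a₀ = 1) (ha₁ : a₁ * a₁ = 1)
    (hb₀ : b₀ * b₀ = 1) (hb₁ : b₁ * b₁ = 1)
    (h₀₀ : b₀ * a₀ = a₀ * b₀) (h₀₁ : b₀ * a₁ = a₁ * b₀)
    (h₁₀ : b₁ * a₀ = a₀ * b₁) (h₁₁ : b₁ * a₁ = a₁ * b₁) :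
    (β • b₀ + (a₀ + a₁) * b₀ + (a₀ - a₁) * b₁) * (β • b₀ + (a₀ + a₁) * b₀ + (a₀ - a₁) * b₁)
      + (β • b₁ - (a₀ + a₁) * b₁ - (a₀ - a₁) * b₀) * (β • b₁ - (a₀ + a₁) * b₁ - (a₀ - a₁) * b₀)
      = (2 * (4 + β ^ 2)) • (1 : R) := by
  have e₁ (x : R) : a₀ * (a₀ * x) = x := by rw [← mul_assoc, ha₀, one_mul]
  have e₂ (x : R) : a₁ * (a₁ * x) = x := by rw [← mul_assoc, ha₁, one_mul]
  have e₅ (x : R) : b₀ * (a₀ * x) = a₀ * (b₀ * x) := by rw [← mul_assoc, h₀₀, mul_assoc]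
  have e₆ (x : R) : b₀ * (a₁ * x) = a₁ * (b₀ * x) := by rw [← mul_assoc, h₀₁, mul_assoc]
  have e₇ (x : R) : b₁ * (a₀ * x) = a₀ * (b₁ * x) := by rw [← mul_assoc, h₁₀, mul_assoc]
  have e₈ (x : R) : b₁ * (a₁ * x) = a₁ * (b₁ * x) := by rw [← mul_assoc, h₁₁, mul_assoc]
  simp only [add_mul, mul_add, sub_mul, mul_sub, smul_mul_assoc, mul_smul_comm, mul_assoc,
    ha₀, ha₁, hb₀, hb₁, e₁, e₂, e₅, e₆, e₇, e₈, mul_one]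
  module

section StarAlgebra

variable {R : Type*} [Ring R] [StarRing R] [Algebra ℝ R] [StarModule ℝ R]

/-- A vector annihilated by `x` in the GNS sense is annihilated by every `y * x`. -/
theorem map_mul_eq_zero_of_map_star_mul_self (ρ : R →ₗ[ℝ] ℝ)
    (hpos : ∀ x, 0 ≤ ρ (star x * x)) (hstar : ∀ x, ρ (star x) = ρ x)
    {x : R} (hx : ρ (star x * x) = 0) (y : R) : ρ (y * x) = 0 := by
  have key : ∀ t : ℝ, 0 ≤ 2 * t * ρ (y * x) + ρ (y * star y) := by
    intro t
    have h := hpos (t • x + star y)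
    have h1 : ρ (star x * star y) = ρ (y * x) := by rw [← star_mul, hstar]
    simp only [star_add, star_smul, star_trivial, star_star, add_mul, mul_add, smul_mul_assoc,
      mul_smul_comm, map_add, map_smul, smul_eq_mul, hx, h1] at h
    linarith
  by_contra hne
  have h := key (-(ρ (y * star y) + 1) / (2 * ρ (y * x)))
  have h2 : 2 * (-(ρ (y * star y) + 1) / (2 * ρ (y * x))) * ρ (y * x)
      = -(ρ (y * star y) + 1) := by
    field_simp
  linarith

variable {ρ : R →ₗ[ℝ] ℝ} {a₀ a₁ b₀ b₁ : R} {β s : ℝ}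

/-- At maximal violation, the shifted Bell operator and its companion annihilate the state. -/
theorem tiltedBell_annihilates (hpos : ∀ x, 0 ≤ ρ (star x * x)) (hstar : ∀ x, ρ (star x) = ρ x)
    (hone : ρ 1 = 1) (hs : s ^ 2 = 2 * (4 + β ^ 2))
    (sa₀ : star a₀ = a₀) (sa₁ : star a₁ = a₁) (sb₀ : star b₀ = b₀) (sb₁ : star b₁ = b₁)
    (ha₀ : a₀ * a₀ = 1) (ha₁ : a₁ * a₁ = 1) (hb₀ : b₀ * b₀ = 1) (hb₁ : b₁ * b₁ = 1)
    (h₀₀ : b₀ * a₀ = a₀ * b₀) (h₀₁ : b₀ * a₁ = a₁ * b₀)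
    (h₁₀ : b₁ * a₀ = a₀ * b₁) (h₁₁ : b₁ * a₁ = a₁ * b₁)
    (hmax : ρ (β • b₀ + (a₀ + a₁) * b₀ + (a₀ - a₁) * b₁) = s) :
    (∀ y, ρ (y * (β • b₀ + (a₀ + a₁) * b₀ + (a₀ - a₁) * b₁ - s • 1)) = 0) ∧
      ∀ y, ρ (y * (β • b₁ - (a₀ + a₁) * b₁ - (a₀ - a₁) * b₀)) = 0 := by
  have hsum := congrArg ρ (tiltedBell_sq_add_sq (β := β) ha₀ ha₁ hb₀ hb₁ h₀₀ h₀₁ h₁₀ h₁₁)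
  have sI : star (β • b₀ + (a₀ + a₁) * b₀ + (a₀ - a₁) * b₁)
      = β • b₀ + (a₀ + a₁) * b₀ + (a₀ - a₁) * b₁ := by
    simp only [star_add, star_sub, star_smul, star_mul, star_trivial, sa₀, sa₁, sb₀, sb₁, add_mul,
      sub_mul, h₀₀, h₀₁, h₁₀, h₁₁]
  have sJ : star (β • b₁ - (a₀ + a₁) * b₁ - (a₀ - a₁) * b₀)
      = β • b₁ - (a₀ + a₁) * b₁ - (a₀ - a₁) * b₀ := by
    simp only [star_add, star_sub, star_smul, star_mul, star_trivial, sa₀, sa₁, sb₀, sb₁, add_mul,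
      sub_mul, h₀₀, h₀₁, h₁₀, h₁₁]
  set I := β • b₀ + (a₀ + a₁) * b₀ + (a₀ - a₁) * b₁
  set J := β • b₁ - (a₀ + a₁) * b₁ - (a₀ - a₁) * b₀
  have hJ := hpos J
  have hI := hpos (I - s • 1)
  have hexp : ρ (star (I - s • 1) * (I - s • 1)) = ρ (I * I) - s ^ 2 := by
    simp only [star_sub, star_smul, star_one, star_trivial, sI, sub_mul, mul_sub, smul_mul_assoc,
      mul_smul_comm, mul_one, one_mul, map_sub, map_smul, hmax, hone, smul_eq_mul]
    ring
  rw [sJ] at hJ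
  simp only [map_add, map_smul, hone, smul_eq_mul] at hsum
  exact ⟨map_mul_eq_zero_of_map_star_mul_self ρ hpos hstar (by linarith),
    map_mul_eq_zero_of_map_star_mul_self ρ hpos hstar (by rw [sJ]; linarith)⟩

/-- Maximal violation is impossible when the measurements of one party commute. -/
theorem not_maximal_of_commutator_mul_eq_zero
    (hpos : ∀ x, 0 ≤ ρ (star x * x)) (hstar : ∀ x, ρ (star x) = ρ x)
    (hone : ρ 1 = 1) (hs : s ^ 2 = 2 * (4 + β ^ 2)) (hβ : 0 ≤ β) (hβ2 : β < 2)
    (sa₀ : star a₀ = a₀) (sa₁ : star a₁ = a₁) (sb₀ : star b₀ = b₀) (sb₁ : star b₁ = b₁)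
    (ha₀ : a₀ * a₀ = 1) (ha₁ : a₁ * a₁ = 1) (hb₀ : b₀ * b₀ = 1) (hb₁ : b₁ * b₁ = 1)
    (h₀₀ : b₀ * a₀ = a₀ * b₀) (h₀₁ : b₀ * a₁ = a₁ * b₀)
    (h₁₀ : b₁ * a₀ = a₀ * b₁) (h₁₁ : b₁ * a₁ = a₁ * b₁)
    (hcomm : (a₁ * a₀ - a₀ * a₁) * (b₀ * b₁ - b₁ * b₀) = 0) :
    ρ (β • b₀ + (a₀ + a₁) * b₀ + (a₀ - a₁) * b₁) ≠ s := by
  intro hmax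
  have hI := (tiltedBell_annihilates hpos hstar hone hs sa₀ sa₁ sb₀ sb₁ ha₀ ha₁ hb₀ hb₁
    h₀₀ h₀₁ h₁₀ h₁₁ hmax).1 (β • b₀ + (a₀ + a₁) * b₀ + (a₀ - a₁) * b₁)
  have hp := hpos ((b₀ + b₁) * (1 - a₀))
  have hm := hpos ((b₀ - b₁) * (1 - a₁))
  have hc := congrArg ρ hcomm
  rw [mul_sub, map_sub, mul_smul_comm, mul_one, map_smul, hmax] at hI
  have e₁ (x : R) : a₀ * (a₀ * x) = x := by rw [← mul_assoc, ha₀, one_mul]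
  have e₂ (x : R) : a₁ * (a₁ * x) = x := by rw [← mul_assoc, ha₁, one_mul]
  have e₅ (x : R) : b₀ * (a₀ * x) = a₀ * (b₀ * x) := by rw [← mul_assoc, h₀₀, mul_assoc]
  have e₆ (x : R) : b₀ * (a₁ * x) = a₁ * (b₀ * x) := by rw [← mul_assoc, h₀₁, mul_assoc]
  have e₇ (x : R) : b₁ * (a₀ * x) = a₀ * (b₁ * x) := by rw [← mul_assoc, h₁₀, mul_assoc]
  have e₈ (x : R) : b₁ * (a₁ * x) = a₁ * (b₁ * x) := by rw [← mul_assoc, h₁₁, mul_assoc]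
  simp only [star_mul, star_add, star_sub, sa₀, sa₁, sb₀, sb₁,
    add_mul, mul_add, sub_mul, mul_sub, smul_mul_assoc, mul_smul_comm, mul_assoc,
    ha₀, ha₁, hb₀, hb₁, h₀₀, h₀₁, h₁₀, h₁₁, e₁, e₂, e₅, e₆, e₇, e₈, mul_one,
    map_add, map_sub, map_smul, smul_eq_mul, hone, map_zero] at hI hp hm hc
  nlinarith [mul_nonneg hβ (add_nonneg hp hm), sq_pos_of_pos (sub_pos.2 hβ2)]

/-- The real algebra behind `map_eq_zero_of_maximal_of_anticommutator_scalar`: `p`, `m` and `q` are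
the means of `a₀ + a₁`, `a₀ - a₁` and `b₁`, and `x`, `y`, `d` are correlations. -/
theorem eq_zero_of_moment_relations {β s a c p m q x y d : ℝ} (hβ2 : β ^ 2 < 4)
    (hs : s ^ 2 = 2 * (4 + β ^ 2))
    (F₁ : s * q = m + c * (β + p)) (F₂ : c * (β - p) = m) (F₃ : β * y = (2 + 2 * a) * q)
    (F₄ : β * q - y = d) (F₅ : β * d + (2 - 2 * a) * q = s * m)
    (F₆ : 2 * β * p = β ^ 2 + 4 * a) (F₇ : 2 * (2 + 2 * a) = s * x)
    (F₈ : 4 * c ^ 2 * (2 + 2 * a + β ^ 2 - 2 * β * p) = s ^ 2 - 4 * s * x + 4 * (2 + 2 * a)) :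
    q = 0 := by
  have hs0 : s ≠ 0 := by rintro rfl; nlinarith [sq_nonneg β]
  have G : s * q = 2 * c * β := by linarith
  by_contra hq
  have hc : c ≠ 0 := by
    rintro rfl
    exact mul_ne_zero hs0 hq (by linarith)
  have ha : 4 * a = β ^ 2 := by
    have h : c * ((s ^ 2 - 4 * β ^ 2) * (β ^ 2 - 4 * a)) = 0 := by
      subst F₄ F₂
      linear_combination -2 * β * s * F₅ - 2 * β * s * F₃ + 2 * β * (β ^ 2 - 4 * a) * G
        + s ^ 2 * c * F₆
    have h' : s ^ 2 - 4 * β ^ 2 ≠ 0 := by linarith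
    linarith [(mul_eq_zero.1 ((mul_eq_zero.1 h).resolve_left hc)).resolve_left h']
  have h : c ^ 2 * (4 - β ^ 2) = 0 := by
    linear_combination F₈ / 2 + hs / 2 + 2 * F₇ + 2 * c ^ 2 * F₆ + (c ^ 2 - 1) * ha
  linarith [(mul_eq_zero.1 h).resolve_left (pow_ne_zero 2 hc)]

set_option maxHeartbeats 1600000 in
/-- At maximal violation `b₁` is unbiased when both anticommutators are scalar. -/
theorem map_eq_zero_of_maximal_of_anticommutator_scalar
    (hpos : ∀ x, 0 ≤ ρ (star x * x)) (hstar : ∀ x, ρ (star x) = ρ x)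
    (hone : ρ 1 = 1) (hs : s ^ 2 = 2 * (4 + β ^ 2)) (hβ : 0 ≤ β) (hβ2 : β < 2)
    (sa₀ : star a₀ = a₀) (sa₁ : star a₁ = a₁) (sb₀ : star b₀ = b₀) (sb₁ : star b₁ = b₁)
    (ha₀ : a₀ * a₀ = 1) (ha₁ : a₁ * a₁ = 1) (hb₀ : b₀ * b₀ = 1) (hb₁ : b₁ * b₁ = 1)
    (h₀₀ : b₀ * a₀ = a₀ * b₀) (h₀₁ : b₀ * a₁ = a₁ * b₀)
    (h₁₀ : b₁ * a₀ = a₀ * b₁) (h₁₁ : b₁ * a₁ = a₁ * b₁) {a c : ℝ}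
    (ha : a₀ * a₁ + a₁ * a₀ = (2 * a) • 1) (hb : b₀ * b₁ + b₁ * b₀ = (2 * c) • 1)
    (hmax : ρ (β • b₀ + (a₀ + a₁) * b₀ + (a₀ - a₁) * b₁) = s) : ρ b₁ = 0 := by
  obtain ⟨hI, hJ⟩ := tiltedBell_annihilates hpos hstar hone hs sa₀ sa₁ sb₀ sb₁ ha₀ ha₁ hb₀ hb₁
    h₀₀ h₀₁ h₁₀ h₁₁ hmax
  have ha' : a₁ * a₀ = (2 * a) • 1 - a₀ * a₁ := by rw [← ha]; abel
  have hb' : b₁ * b₀ = (2 * c) • 1 - b₀ * b₁ := by rw [← hb]; abel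
  have e₁ (x : R) : a₀ * (a₀ * x) = x := by rw [← mul_assoc, ha₀, one_mul]
  have e₂ (x : R) : a₁ * (a₁ * x) = x := by rw [← mul_assoc, ha₁, one_mul]
  have e₃ (x : R) : b₀ * (b₀ * x) = x := by rw [← mul_assoc, hb₀, one_mul]
  have e₅ (x : R) : b₀ * (a₀ * x) = a₀ * (b₀ * x) := by rw [← mul_assoc, h₀₀, mul_assoc]
  have e₆ (x : R) : b₀ * (a₁ * x) = a₁ * (b₀ * x) := by rw [← mul_assoc, h₀₁, mul_assoc]
  have e₇ (x : R) : b₁ * (a₀ * x) = a₀ * (b₁ * x) := by rw [← mul_assoc, h₁₀, mul_assoc]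
  have e₈ (x : R) : b₁ * (a₁ * x) = a₁ * (b₁ * x) := by rw [← mul_assoc, h₁₁, mul_assoc]
  have e₉ (x : R) : a₁ * (a₀ * x) = (2 * a) • x - a₀ * (a₁ * x) := by
    rw [← mul_assoc, ha', sub_mul, smul_mul_assoc, one_mul, mul_assoc]
  have e₁₀ (x : R) : b₁ * (b₀ * x) = (2 * c) • x - b₀ * (b₁ * x) := by
    rw [← mul_assoc, hb', sub_mul, smul_mul_assoc, one_mul, mul_assoc]
  have w₁ := hstar (a₀ * a₁)
  have w₂ := hstar (b₀ * b₁)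
  have w₃ := hstar (a₀ * (b₀ * b₁))
  have w₄ := hstar (a₁ * (b₀ * b₁))
  have w₅ := hstar (a₀ * (a₁ * b₀))
  have w₆ := hstar (a₀ * (a₁ * b₁))
  have E₁ := hI b₁
  have E₂ := hJ b₀
  have E₃ := hJ (a₀ + a₁)
  have E₄ := hJ 1
  have E₅ := hI (a₀ - a₁)
  have E₆ := hJ ((β • 1 - (a₀ + a₁)) * b₁ + (a₀ - a₁) * b₀)
  have E₇ := hI ((a₀ + a₁) * b₀)
  have E₈ := hI ((2 * c) • ((β • 1 - (a₀ + a₁)) * b₁) + s • 1 - (2 : ℝ) • ((a₀ + a₁) * b₀))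
  have E₉ := hJ (((2 * c) • ((β • 1 - (a₀ + a₁)) * b₁) + s • 1 - (2 : ℝ) • ((a₀ + a₁) * b₀))
    * (b₁ * b₀))
  have E₁₀ := hJ ((a₀ + a₁) * b₁)
  simp only [star_mul, sa₀, sa₁, sb₀, sb₁,
    add_mul, mul_add, sub_mul, mul_sub, smul_mul_assoc, mul_smul_comm, mul_assoc, smul_add,
    smul_sub, ha₀, ha₁, hb₀, hb₁, h₀₀, h₀₁, h₁₀, h₁₁, ha', hb', e₁, e₂, e₃, e₅, e₆, e₇, e₈,
    e₉, e₁₀, mul_one, one_mul, map_add, map_sub, map_smul, smul_eq_mul, hone]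
    at w₁ w₂ w₃ w₄ w₅ w₆ E₁ E₂ E₃ E₄ E₅ E₆ E₇ E₈ E₉ E₁₀
  replace w₁ : ρ (a₀ * a₁) = a := by linarith
  replace w₂ : ρ (b₀ * b₁) = c := by linarith
  replace w₃ : ρ (a₀ * (b₀ * b₁)) = c * ρ a₀ := by linarith
  replace w₄ : ρ (a₁ * (b₀ * b₁)) = c * ρ a₁ := by linarith
  replace w₅ : ρ (a₀ * (a₁ * b₀)) = a * ρ b₀ := by linarith
  replace w₆ : ρ (a₀ * (a₁ * b₁)) = a * ρ b₁ := by linarith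
  simp only [w₁, w₂, w₃, w₄, w₅, w₆] at E₁ E₂ E₃ E₄ E₅ E₆ E₇ E₈ E₉ E₁₀
  generalize ρ (a₀ * (a₁ * (b₀ * b₁))) = z at *
  generalize ρ (a₀ * b₀) = x₀₀ at *
  generalize ρ (a₀ * b₁) = x₀₁ at *
  generalize ρ (a₁ * b₀) = x₁₀ at *
  generalize ρ (a₁ * b₁) = x₁₁ at *
  generalize ρ a₀ = p₀ at *
  generalize ρ a₁ = p₁ at *
  generalize ρ b₀ = q₀ at *
  generalize ρ b₁ = q₁ at *
  exact eq_zero_of_moment_relations (β := β) (s := s) (a := a) (c := c) (p := p₀ + p₁)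
    (m := p₀ - p₁) (x := x₀₀ + x₁₀) (y := x₀₁ + x₁₁) (d := x₀₀ - x₁₀) (by nlinarith) hs
    (by linarith) (by linarith) (by linarith) (by linarith) (by linarith) (by linarith)
    (by linarith) (by linarith)

end StarAlgebra

theorem eq_one_or_eq_neg_one_or_trace_eq_zero {A : Matrix (Fin 2) (Fin 2) ℂ} (h : A * A = 1) :
    A = 1 ∨ A = -1 ∨ A 1 1 = -A 0 0 := by
  have h00 := congrFun (congrFun h 0) 0
  have h01 := congrFun (congrFun h 0) 1
  have h10 := congrFun (congrFun h 1) 0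
  have h11 := congrFun (congrFun h 1) 1
  simp [Matrix.mul_apply, Fin.sum_univ_two] at h00 h01 h10 h11
  by_cases ht : A 0 0 + A 1 1 = 0
  · exact Or.inr (Or.inr (by linear_combination ht))
  have hb : A 0 1 = 0 := (mul_eq_zero.1 (by linear_combination h01 :
    A 0 1 * (A 0 0 + A 1 1) = 0)).resolve_right ht
  have hc : A 1 0 = 0 := (mul_eq_zero.1 (by linear_combination h10 :
    A 1 0 * (A 0 0 + A 1 1) = 0)).resolve_right ht
  have hd : A 0 0 = A 1 1 := by
    have : (A 0 0 - A 1 1) * (A 0 0 + A 1 1) = 0 := by linear_combination h00 - h11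
    linear_combination (mul_eq_zero.1 this).resolve_right ht
  have hsq : (A 0 0 - 1) * (A 0 0 + 1) = 0 := by
    linear_combination h00 - A 1 0 * hb
  rcases mul_eq_zero.1 hsq with h1 | h1
  · left
    ext i j
    fin_cases i <;> fin_cases j <;> simp [hb, hc, ← hd, sub_eq_zero.1 h1]
  · right; left
    ext i j
    fin_cases i <;> fin_cases j <;> simp [hb, hc, ← hd, eq_neg_of_add_eq_zero_left h1]

/-- Two qubit observables either commute or have a real scalar anticommutator. -/
theorem commute_or_anticommutator_scalar {A B : Matrix (Fin 2) (Fin 2) ℂ}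
    (hA : A.IsHermitian) (hB : B.IsHermitian) (hA2 : A * A = 1) (hB2 : B * B = 1) :
    A * B = B * A ∨ ∃ c : ℝ, A * B + B * A = (2 * c) • (1 : Matrix (Fin 2) (Fin 2) ℂ) := by
  rcases eq_one_or_eq_neg_one_or_trace_eq_zero hA2 with rfl | rfl | hA'
  · simp
  · simp
  rcases eq_one_or_eq_neg_one_or_trace_eq_zero hB2 with rfl | rfl | hB'
  · simp
  · simp
  right
  have a0 := hA.apply 0 0
  have a1 := hA.apply 1 0
  have b0 := hB.apply 0 0
  have b1 := hB.apply 1 0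
  refine ⟨(A 0 0).re * (B 0 0).re + (A 0 1).re * (B 0 1).re + (A 0 1).im * (B 0 1).im, ?_⟩
  have ia : (A 0 0).im = 0 := Complex.conj_eq_iff_im.1 a0
  have ib : (B 0 0).im = 0 := Complex.conj_eq_iff_im.1 b0
  ext i j
  fin_cases i <;> fin_cases j <;> apply Complex.ext <;>
    simp [Matrix.mul_apply, Fin.sum_univ_two, hA', hB', ← a1, ← b1, ia, ib] <;> ring

/-- The real part of the expectation value in the state `ψ`, as a real-linear functional. -/
def expectationRe {n : Type*} [Fintype n] (ψ : n → ℂ) : Matrix n n ℂ →ₗ[ℝ] ℝ where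
  toFun X := (star ψ ⬝ᵥ X.mulVec ψ).re
  map_add' X Y := by simp [Matrix.add_mulVec]
  map_smul' r X := by simp [Matrix.smul_mulVec]

theorem conj_expectation {n : Type*} [Fintype n] (ψ : n → ℂ) (X : Matrix n n ℂ) :
    star (star ψ ⬝ᵥ X.mulVec ψ) = star ψ ⬝ᵥ (star X).mulVec ψ := by
  rw [Matrix.star_dotProduct, Matrix.star_mulVec, star_star, Matrix.star_eq_conjTranspose,
    Matrix.dotProduct_mulVec, dotProduct_comm]

theorem expectationRe_star {n : Type*} [Fintype n] (ψ : n → ℂ) (X : Matrix n n ℂ) :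
    expectationRe ψ (star X) = expectationRe ψ X := by
  change (star ψ ⬝ᵥ (star X).mulVec ψ).re = (star ψ ⬝ᵥ X.mulVec ψ).re
  rw [← conj_expectation]
  exact Complex.conj_re _

open scoped ComplexOrder in
theorem expectationRe_star_mul_self_nonneg {n : Type*} [Fintype n] (ψ : n → ℂ)
    (X : Matrix n n ℂ) : 0 ≤ expectationRe ψ (star X * X) :=
  (Complex.le_def.1 ((Matrix.posSemidef_conjTranspose_mul_self X).dotProduct_mulVec_nonneg ψ)).1

theorem randomness_at_maximal_violation (β : ℝ) (hβ : β ∈ Set.Ico (0 : ℝ) 2)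
    (ψ : Fin 2 × Fin 2 → ℂ) (hψ : star ψ ⬝ᵥ ψ = 1)
    (A0 A1 B0 B1 : Matrix (Fin 2) (Fin 2) ℂ)
    (hA0 : A0.IsHermitian) (hA1 : A1.IsHermitian)
    (hB0 : B0.IsHermitian) (hB1 : B1.IsHermitian)
    (hA0sq : A0 * A0 = 1) (hA1sq : A1 * A1 = 1)
    (hB0sq : B0 * B0 = 1) (hB1sq : B1 * B1 = 1)
    (hmax : (β : ℂ) * expVal 1 B0 ψ + (expVal A0 B0 ψ + expVal A1 B0 ψ)
        + expVal A0 B1 ψ - expVal A1 B1 ψ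
        = (Real.sqrt (2 * (4 + β ^ 2)) : ℂ)) :
    expVal 1 B1 ψ = 0 := by
  have hs : Real.sqrt (2 * (4 + β ^ 2)) ^ 2 = 2 * (4 + β ^ 2) := Real.sq_sqrt (by positivity)
  have hpos := expectationRe_star_mul_self_nonneg ψ
  have hstar := expectationRe_star ψ
  have hone : expectationRe ψ 1 = 1 := by
    change (star ψ ⬝ᵥ (1 : Matrix _ _ ℂ).mulVec ψ).re = 1
    rw [Matrix.one_mulVec, hψ, Complex.one_re]
  have hval (A B : Matrix (Fin 2) (Fin 2) ℂ) :
      expectationRe ψ ((A ⊗ₖ 1) * (1 ⊗ₖ B)) = (expVal A B ψ).re := by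
    rw [← Matrix.mul_kronecker_mul, mul_one, one_mul]
    rfl
  have hval1 (B : Matrix (Fin 2) (Fin 2) ℂ) :
      expectationRe ψ (1 ⊗ₖ B) = (expVal 1 B ψ).re := rfl
  have hI : expectationRe ψ (β • ((1 : Matrix (Fin 2) (Fin 2) ℂ) ⊗ₖ B0)
      + (A0 ⊗ₖ 1 + A1 ⊗ₖ 1) * (1 ⊗ₖ B0) + (A0 ⊗ₖ 1 - A1 ⊗ₖ 1) * (1 ⊗ₖ B1))
      = Real.sqrt (2 * (4 + β ^ 2)) := by
    have h := congrArg Complex.re hmax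
    simp only [Complex.add_re, Complex.sub_re, Complex.re_ofReal_mul, Complex.ofReal_re] at h
    simp only [add_mul, sub_mul, map_add, map_sub, map_smul, hval, hval1, smul_eq_mul]
    linarith
  have sA {A : Matrix (Fin 2) (Fin 2) ℂ} (h : A.IsHermitian) :
      star (A ⊗ₖ (1 : Matrix (Fin 2) (Fin 2) ℂ)) = A ⊗ₖ 1 := by
    rw [Matrix.star_eq_conjTranspose, Matrix.conjTranspose_kronecker, h.eq,
      Matrix.conjTranspose_one]
  have sB {B : Matrix (Fin 2) (Fin 2) ℂ} (h : B.IsHermitian) :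
      star ((1 : Matrix (Fin 2) (Fin 2) ℂ) ⊗ₖ B) = 1 ⊗ₖ B := by
    rw [Matrix.star_eq_conjTranspose, Matrix.conjTranspose_kronecker, h.eq,
      Matrix.conjTranspose_one]
  have mA (A A' : Matrix (Fin 2) (Fin 2) ℂ) :
      (A ⊗ₖ (1 : Matrix (Fin 2) (Fin 2) ℂ)) * (A' ⊗ₖ 1) = (A * A') ⊗ₖ 1 := by
    rw [← Matrix.mul_kronecker_mul, mul_one]
  have mB (B B' : Matrix (Fin 2) (Fin 2) ℂ) :
      ((1 : Matrix (Fin 2) (Fin 2) ℂ) ⊗ₖ B) * (1 ⊗ₖ B') = 1 ⊗ₖ (B * B') := by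
    rw [← Matrix.mul_kronecker_mul, mul_one]
  have qA {A : Matrix (Fin 2) (Fin 2) ℂ} (h : A * A = 1) :
      (A ⊗ₖ (1 : Matrix (Fin 2) (Fin 2) ℂ)) * (A ⊗ₖ 1) = 1 := by
    rw [mA, h, Matrix.one_kronecker_one]
  have qB {B : Matrix (Fin 2) (Fin 2) ℂ} (h : B * B = 1) :
      ((1 : Matrix (Fin 2) (Fin 2) ℂ) ⊗ₖ B) * (1 ⊗ₖ B) = 1 := by
    rw [mB, h, Matrix.one_kronecker_one]
  have cAB (A B : Matrix (Fin 2) (Fin 2) ℂ) :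
      ((1 : Matrix (Fin 2) (Fin 2) ℂ) ⊗ₖ B) * (A ⊗ₖ 1) = (A ⊗ₖ 1) * (1 ⊗ₖ B) := by
    simp only [← Matrix.mul_kronecker_mul, mul_one, one_mul]
  have hne := not_maximal_of_commutator_mul_eq_zero hpos hstar hone hs hβ.1 hβ.2
    (sA hA0) (sA hA1) (sB hB0) (sB hB1) (qA hA0sq) (qA hA1sq) (qB hB0sq) (qB hB1sq)
    (cAB _ _) (cAB _ _) (cAB _ _) (cAB _ _)
  rcases commute_or_anticommutator_scalar hA0 hA1 hA0sq hA1sq with hA | ⟨a, ha⟩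
  · exact absurd hI (hne (by rw [mA, mA, hA, sub_self, zero_mul]))
  rcases commute_or_anticommutator_scalar hB0 hB1 hB0sq hB1sq with hB | ⟨c, hc⟩
  · exact absurd hI (hne (by rw [mB, mB, hB, sub_self, mul_zero]))
  have hre := map_eq_zero_of_maximal_of_anticommutator_scalar hpos hstar hone hs hβ.1 hβ.2
    (sA hA0) (sA hA1) (sB hB0) (sB hB1) (qA hA0sq) (qA hA1sq) (qB hB0sq) (qB hB1sq)
    (cAB _ _) (cAB _ _) (cAB _ _) (cAB _ _) (a := a) (c := c)
    (by rw [mA, mA, ← Matrix.add_kronecker, ha, Matrix.smul_kronecker, Matrix.one_kronecker_one])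
    (by rw [mB, mB, ← Matrix.kronecker_add, hc, Matrix.kronecker_smul, Matrix.one_kronecker_one])
    hI
  have him := conj_expectation ψ ((1 : Matrix (Fin 2) (Fin 2) ℂ) ⊗ₖ B1)
  rw [sB hB1] at him
  exact Complex.ext hre (Complex.conj_eq_iff_im.1 him)
end
end
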